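/- Let γ₁, γ₂ ∈ ℝ, let U ⊆ ℝ² be open, and let K, τ : U → ℝ be differentiable with K > 0 on U. Define β = −τ + iK. Then (K, τ) satisfies the system K_y + [2τ − γ₁(3τ² − (3/2)K²)]K_x + [K − 3γ₁τK − γ₂/K]τ_x = 0, τ_y − [K − 3γ₁τK − γ₂/K]K_x + [2τ − γ₁(3τ² − (3/2)K²)]τ_x = 0 on U if and only if β satisfies β_y = λ·β_x on U, where λ = (1/2)(3β + β̄) + γ₁(3/8)(5β² + 2ββ̄ + β̄²) + 2γ₂/(β − β̄). -/

import Mathlib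

/-- The Fréchet derivative of `-g + i f`, for real-valued `f` and `g`. -/
theorem fderiv_neg_ofReal_add_I_mul_ofReal {E : Type*} [NormedAddCommGroup E] [NormedSpace ℝ E]
    {f g : E → ℝ} {p : E} (hf : DifferentiableAt ℝ f p) (hg : DifferentiableAt ℝ g p) (v : E) :
    fderiv ℝ (fun q => -(g q : ℂ) + Complex.I * (f q : ℂ)) p v =
      -((fderiv ℝ g p v : ℝ) : ℂ) + Complex.I * ((fderiv ℝ f p v : ℝ) : ℂ) := by
  have hf' : HasFDerivAt (fun q => (f q : ℂ)) (Complex.ofRealCLM.comp (fderiv ℝ f p)) p :=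
    Complex.ofRealCLM.hasFDerivAt.comp p hf.hasFDerivAt
  have hg' : HasFDerivAt (fun q => (g q : ℂ)) (Complex.ofRealCLM.comp (fderiv ℝ g p)) p :=
    Complex.ofRealCLM.hasFDerivAt.comp p hg.hasFDerivAt
  rw [HasFDerivAt.fderiv (hg'.fun_neg.fun_add (hf'.const_mul Complex.I))]
  simp

/-- The characteristic velocity at `β = -t + i k`, split into real and imaginary parts. -/
theorem characteristic_velocity_eq (γ₁ γ₂ k t : ℝ) (hk : k ≠ 0) (b : ℂ)
    (hb : b = -(t : ℂ) + Complex.I * (k : ℂ)) :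
    (1 / 2) * (3 * b + starRingEnd ℂ b)
      + (γ₁ : ℂ) * (3 / 8) * (5 * b ^ 2 + 2 * b * starRingEnd ℂ b + (starRingEnd ℂ b) ^ 2)
      + 2 * (γ₂ : ℂ) / (b - starRingEnd ℂ b) =
    -((2 * t - γ₁ * (3 * t ^ 2 - (3 / 2) * k ^ 2) : ℝ) : ℂ)
      + Complex.I * ((k - 3 * γ₁ * t * k - γ₂ / k : ℝ) : ℂ) := by
  have hconj : starRingEnd ℂ b = -(t : ℂ) - Complex.I * (k : ℂ) := by
    rw [hb]
    simp [sub_eq_add_neg]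
  have hk' : (k : ℂ) ≠ 0 := Complex.ofReal_ne_zero.mpr hk
  have hdiv : 2 * (γ₂ : ℂ) / (b - starRingEnd ℂ b) = -Complex.I * (γ₂ / k) := by
    have hsub : b - starRingEnd ℂ b = 2 * Complex.I * k := by
      rw [hconj, hb]
      ring
    rw [hsub, div_eq_iff (by simp [hk])]
    field_simp
    linear_combination (γ₂ : ℂ) * Complex.I_sq
  rw [hdiv, hconj, hb]
  push_cast
  linear_combination ((3 / 2) * (γ₁ : ℂ) * k ^ 2) * Complex.I_sq

/-- the quasiclassical intrinsic system with axial flow (γ₁) and dToda (γ₂)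
contributions for curvature K > 0 and torsion τ is equivalent to the complex equation
β_y = λ(β,β̄) β_x for the Riemann invariant β = −τ + iK. -/
theorem stmt_3 (γ₁ γ₂ : ℝ) (U : Set (ℝ × ℝ)) (hU : IsOpen U)
    (K τ : ℝ × ℝ → ℝ)
    (hK : ∀ p ∈ U, DifferentiableAt ℝ K p)
    (hτ : ∀ p ∈ U, DifferentiableAt ℝ τ p)
    (hKpos : ∀ p ∈ U, 0 < K p)
    (β : ℝ × ℝ → ℂ)
    (hβ : ∀ p, β p = -(τ p : ℂ) + Complex.I * (K p : ℂ)) :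
    (∀ p ∈ U,
        fderiv ℝ K p (0, 1)
            + (2 * τ p - γ₁ * (3 * (τ p) ^ 2 - (3 / 2) * (K p) ^ 2)) * fderiv ℝ K p (1, 0)
            + (K p - 3 * γ₁ * τ p * K p - γ₂ / K p) * fderiv ℝ τ p (1, 0) = 0 ∧
        fderiv ℝ τ p (0, 1)
            - (K p - 3 * γ₁ * τ p * K p - γ₂ / K p) * fderiv ℝ K p (1, 0)
            + (2 * τ p - γ₁ * (3 * (τ p) ^ 2 - (3 / 2) * (K p) ^ 2)) * fderiv ℝ τ p (1, 0) = 0) ↔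
    (∀ p ∈ U,
        fderiv ℝ β p (0, 1) =
          ((1 / 2) * (3 * β p + starRingEnd ℂ (β p))
            + (γ₁ : ℂ) * (3 / 8) * (5 * (β p) ^ 2 + 2 * (β p) * (starRingEnd ℂ (β p))
                + (starRingEnd ℂ (β p)) ^ 2)
            + 2 * (γ₂ : ℂ) / (β p - starRingEnd ℂ (β p))) * fderiv ℝ β p (1, 0)) := by
  obtain rfl : β = fun q => -(τ q : ℂ) + Complex.I * (K q : ℂ) := funext hβ
  refine forall₂_congr fun p hp => ?_
  rw [fderiv_neg_ofReal_add_I_mul_ofReal (hK p hp) (hτ p hp),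
    fderiv_neg_ofReal_add_I_mul_ofReal (hK p hp) (hτ p hp),
    characteristic_velocity_eq γ₁ γ₂ (K p) (τ p) (hKpos p hp).ne' _ rfl]
  generalize 2 * τ p - γ₁ * (3 * (τ p) ^ 2 - (3 / 2) * (K p) ^ 2) = A
  generalize K p - 3 * γ₁ * τ p * K p - γ₂ / K p = B
  rw [Complex.ext_iff]
  simp only [Complex.add_re, Complex.add_im, Complex.neg_re, Complex.neg_im, Complex.mul_re,
    Complex.mul_im, Complex.I_re, Complex.I_im, Complex.ofReal_re, Complex.ofReal_im]
  constructor <;> rintro ⟨h₁, h₂⟩ <;> constructor <;> linarith
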